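/- (Extremal entropy inequality for correlated channels, Lemma 1.) Consider the two-user erasure interference channel with delayed CSIT and spatially correlated links, with parameters 0 < p ≤ 1, q = 1-p, -1 ≤ ρ ≤ 1, blocklength n, and β = 2 - p - q*ρ. Then the conditional Shannon entropies of the output sequences satisfy H[(Y_2[1],...,Y_2[n]) | (W_2, G[1],...,G[n])] ≥ (1/β) · H[(Y_1[1],...,Y_1[n]) | (W_2, G[1],...,G[n])]. -/

import Mathlib

open Classical in
/-- Probability of an event on a finite probability space with weights `μ`. -/
noncomputable def pr {Ω : Type*} [Fintype Ω] (μ : Ω → ℝ) (E : Ω → Prop) : ℝ :=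
  ∑ ω, if E ω then μ ω else 0

/-- Conditional Shannon entropy `H[X | Y]` (natural logarithm):
`∑_y P(Y = y) · H[X | Y = y]`. -/
noncomputable def condEnt {Ω A B : Type*} [Fintype Ω] [Fintype A] [Fintype B]
    (μ : Ω → ℝ) (X : Ω → A) (Y : Ω → B) : ℝ :=
  ∑ b, ∑ a, pr μ (fun ω => Y ω = b) *
    Real.negMulLog (pr μ (fun ω => X ω = a ∧ Y ω = b) / pr μ (fun ω => Y ω = b))

/-- Conditional mutual information `I[X : Y | Z]` (natural logarithm). -/
noncomputable def condMI {Ω A B C : Type*} [Fintype Ω] [Fintype A] [Fintype B] [Fintype C]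
    (μ : Ω → ℝ) (X : Ω → A) (Y : Ω → B) (Z : Ω → C) : ℝ :=
  condEnt μ X Z + condEnt μ Y Z - condEnt μ (fun ω => (X ω, Y ω)) Z

/-- Two (finite-valued) random variables are independent. -/
def IndepRV {Ω A B : Type*} [Fintype Ω] (μ : Ω → ℝ) (X : Ω → A) (Y : Ω → B) : Prop :=
  ∀ a b, pr μ (fun ω => X ω = a ∧ Y ω = b) =
    pr μ (fun ω => X ω = a) * pr μ (fun ω => Y ω = b)

/-- The four components of a channel state `G[t] = (G₁₁[t], G₁₂[t], G₂₁[t], G₂₂[t])`. -/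
def g11 (s : ZMod 2 × ZMod 2 × ZMod 2 × ZMod 2) : ZMod 2 := s.1
def g12 (s : ZMod 2 × ZMod 2 × ZMod 2 × ZMod 2) : ZMod 2 := s.2.1
def g21 (s : ZMod 2 × ZMod 2 × ZMod 2 × ZMod 2) : ZMod 2 := s.2.2.1
def g22 (s : ZMod 2 × ZMod 2 × ZMod 2 × ZMod 2) : ZMod 2 := s.2.2.2

open Classical in
/-- Mass of the fibre of `φ` through `w`. -/
noncomputable def fibMass {W α : Type*} [Fintype W] (ν : W → ℝ) (φ : W → α) (w : W) : ℝ :=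
  ∑ w', if φ w' = φ w then ν w' else 0

/-- Entropy of `φ` under the weights `ν`. -/
noncomputable def fEnt {W α : Type*} [Fintype W] (ν : W → ℝ) (φ : W → α) : ℝ :=
  ∑ w, - (ν w * Real.log (fibMass ν φ w))

lemma fEnt_congr {W α α' : Type*} [Fintype W] (ν : W → ℝ) (φ : W → α) (ψ : W → α')
    (h : ∀ w w', φ w = φ w' ↔ ψ w = ψ w') : fEnt ν φ = fEnt ν ψ := by
  classical
  unfold fEnt
  apply Finset.sum_congr rfl
  intro w _
  have : fibMass ν φ w = fibMass ν ψ w := by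
    unfold fibMass
    exact Finset.sum_congr rfl (fun w' _ => if_congr (h w' w) rfl rfl)
  rw [this]

lemma fibMass_congr {W α : Type*} [Fintype W] (ν : W → ℝ) (φ : W → α) {w w' : W}
    (h : φ w = φ w') : fibMass ν φ w = fibMass ν φ w' := by
  classical
  unfold fibMass
  exact Finset.sum_congr rfl (fun v _ => if_congr (by rw [h]) rfl rfl)

lemma fibMass_nonneg {W α : Type*} [Fintype W] (ν : W → ℝ) (hν : ∀ w, 0 ≤ ν w) (φ : W → α)
    (w : W) : 0 ≤ fibMass ν φ w := by
  unfold fibMass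
  apply Finset.sum_nonneg
  intro i _
  split_ifs
  · exact hν i
  · exact le_rfl

lemma le_fibMass {W α : Type*} [Fintype W] (ν : W → ℝ) (hν : ∀ w, 0 ≤ ν w) (φ : W → α)
    (w : W) : ν w ≤ fibMass ν φ w := by
  classical
  have := Finset.single_le_sum (f := fun w' => if φ w' = φ w then ν w' else 0)
    (s := Finset.univ) (fun i _ => by
      split_ifs
      · exact hν i
      · exact le_rfl) (Finset.mem_univ w)
  simp only [if_true] at this
  unfold fibMass
  convert this

lemma fibMass_mono {W α α' : Type*} [Fintype W] (ν : W → ℝ) (hν : ∀ w, 0 ≤ ν w)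
    (φ : W → α) (ψ : W → α')
    (h : ∀ w w', φ w = φ w' → ψ w = ψ w') (w : W) : fibMass ν φ w ≤ fibMass ν ψ w := by
  unfold fibMass
  apply Finset.sum_le_sum
  intro i _
  by_cases h1 : φ i = φ w
  · simp [h1, h _ _ h1]
  · rw [if_neg h1]
    split_ifs
    · exact hν i
    · exact le_rfl

lemma fEnt_mono {W α α' : Type*} [Fintype W] (ν : W → ℝ) (hν : ∀ w, 0 ≤ ν w)
    (φ : W → α) (ψ : W → α')
    (h : ∀ w w', φ w = φ w' → ψ w = ψ w') : fEnt ν ψ ≤ fEnt ν φ := by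
  unfold fEnt
  apply Finset.sum_le_sum
  intro w _
  apply neg_le_neg
  rcases (hν w).eq_or_lt with h0 | h0
  · simp [← h0]
  · apply mul_le_mul_of_nonneg_left _ (hν w)
    apply Real.log_le_log (h0.trans_le (le_fibMass ν hν φ w))
    exact fibMass_mono ν hν φ ψ h w

/-- Submodularity. -/
lemma fEnt_submod {W α α' γ : Type*} [Fintype W] (ν : W → ℝ) (hν : ∀ w, 0 ≤ ν w)
    (A : W → α) (B : W → α') (x : W → γ)
    (h : ∀ w w', B w = B w' → A w = A w') :
    fEnt ν (fun w => (B w, x w)) - fEnt ν B ≤ fEnt ν (fun w => (A w, x w)) - fEnt ν A := by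
  classical
  set mA := fibMass ν A with hmA
  set mB := fibMass ν B with hmB
  set mAx := fibMass ν (fun w => (A w, x w)) with hmAx
  set mBx := fibMass ν (fun w => (B w, x w)) with hmBx
  have nA : ∀ w, 0 ≤ mA w := fibMass_nonneg ν hν _
  have nBx : ∀ w, 0 ≤ mBx w := fibMass_nonneg ν hν _
  have key : ∑ w, ν w * (mAx w * mB w / (mBx w * mA w)) ≤ ∑ w, ν w := by
    have inner : ∀ v u, ∑ w, (if B w = B v ∧ x w = x u then ν w / mBx w else 0) ≤ 1 := by
      intro v u
      by_cases hex : ∃ w₀, B w₀ = B v ∧ x w₀ = x u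
      · obtain ⟨w₀, h1, h2⟩ := hex
        have : ∑ w, (if B w = B v ∧ x w = x u then ν w / mBx w else 0)
            = mBx w₀ / mBx w₀ := by
          conv_rhs => rw [show mBx w₀ / mBx w₀ = (∑ w, if (B w, x w) = (B w₀, x w₀) then ν w else 0) / mBx w₀ by
            simp only [hmBx, fibMass]
            congr!]
          rw [Finset.sum_div]
          apply Finset.sum_congr rfl
          intro w _
          by_cases hc : B w = B v ∧ x w = x u
          · have e : (B w, x w) = (B w₀, x w₀) := by rw [h1, h2, hc.1, hc.2]
            have e2 : mBx w = mBx w₀ := fibMass_congr ν (fun w => (B w, x w)) e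
            rw [if_pos hc, if_pos e, e2]
          · have e : ¬ (B w, x w) = (B w₀, x w₀) := by
              rw [h1, h2, Prod.mk.injEq]; exact hc
            rw [if_neg hc, if_neg e, zero_div]
        rw [this]
        exact div_self_le_one _
      · rw [Finset.sum_eq_zero]
        · exact zero_le_one
        · intro w _
          rw [if_neg]
          intro hc
          exact hex ⟨w, hc⟩
    have expand : ∑ w, ν w * (mAx w * mB w / (mBx w * mA w)) =
        ∑ v, ν v * ((∑ u, (if A u = A v then ν u else 0) *
          ∑ w, (if B w = B v ∧ x w = x u then ν w / mBx w else 0)) / mA v) := by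
      have e1 : ∀ w, ν w * (mAx w * mB w / (mBx w * mA w)) =
          ∑ v, ∑ u, if B w = B v ∧ x w = x u ∧ A u = A v then
            ν v * ν u * (ν w / mBx w) / mA v else 0 := by
        intro w
        have eB : mB w = ∑ v, if B v = B w then ν v else 0 := by
          simp only [hmB, fibMass]
        have eA : mAx w = ∑ u, if (A u, x u) = (A w, x w) then ν u else 0 := by
          simp only [hmAx, fibMass]; congr!
        have : ν w * (mAx w * mB w / (mBx w * mA w)) =
          mB w * (mAx w * (ν w / mBx w / mA w)) := by
            simp only [div_eq_mul_inv, mul_inv]; ring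
        rw [this, eB, eA, Finset.sum_mul]
        apply Finset.sum_congr rfl
        intro v _
        by_cases hv : B v = B w
        · rw [if_pos hv, Finset.sum_mul, Finset.mul_sum]
          apply Finset.sum_congr rfl
          intro u _
          have e3 : mA v = mA w := fibMass_congr ν A (h _ _ hv)
          by_cases hu : (A u, x u) = (A w, x w)
          · rw [if_pos hu, if_pos, e3]
            · ring
            · rw [Prod.mk.injEq] at hu
              exact ⟨hv.symm, hu.2.symm, hu.1.trans (h _ _ hv).symm⟩
          · rw [if_neg hu, if_neg]
            · ring
            · rintro ⟨_, h2, h3⟩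
              apply hu
              rw [h3, h2, h _ _ hv]
        · rw [if_neg hv, zero_mul, Finset.sum_eq_zero]
          intro u _
          rw [if_neg]
          rintro ⟨h1, _⟩
          exact hv h1.symm
      simp only [e1]
      rw [Finset.sum_comm]
      apply Finset.sum_congr rfl
      intro v _
      rw [Finset.sum_comm, Finset.sum_div, Finset.mul_sum]
      apply Finset.sum_congr rfl
      intro u _
      rw [Finset.mul_sum, Finset.sum_div, Finset.mul_sum]
      apply Finset.sum_congr rfl
      intro w _
      by_cases h1 : A u = A v <;> by_cases h2 : B w = B v <;> by_cases h3 : x w = x u <;>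
        simp [h1, h2, h3] <;> ring
    rw [expand]
    apply Finset.sum_le_sum
    intro v _
    have : (∑ u, (if A u = A v then ν u else 0) *
          ∑ w, (if B w = B v ∧ x w = x u then ν w / mBx w else 0)) ≤ mA v := by
      have eA : mA v = ∑ u, if A u = A v then ν u else 0 := by
        simp only [hmA, fibMass]
      rw [eA]
      apply Finset.sum_le_sum
      intro u _
      apply mul_le_of_le_one_right _ (inner v u)
      split_ifs
      · exact hν u
      · exact le_rfl
    exact mul_le_of_le_one_right (hν v) (div_le_one_of_le₀ this (nA v))
  have main : ∑ w, ν w * (Real.log (mAx w) + Real.log (mB w) - Real.log (mBx w)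
      - Real.log (mA w)) ≤ 0 := by
    have : ∑ w, ν w * (Real.log (mAx w) + Real.log (mB w) - Real.log (mBx w)
      - Real.log (mA w)) ≤ ∑ w, (ν w * (mAx w * mB w / (mBx w * mA w)) - ν w) := by
      apply Finset.sum_le_sum
      intro w _
      rcases (hν w).eq_or_lt with h0 | h0
      · simp [← h0]
      · have p1 : 0 < mA w := h0.trans_le (le_fibMass ν hν _ w)
        have p2 : 0 < mB w := h0.trans_le (le_fibMass ν hν _ w)
        have p3 : 0 < mAx w := h0.trans_le (le_fibMass ν hν _ w)
        have p4 : 0 < mBx w := h0.trans_le (le_fibMass ν hν _ w)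
        have := Real.log_le_sub_one_of_pos (x := mAx w * mB w / (mBx w * mA w)) (by positivity)
        rw [Real.log_div (by positivity) (by positivity), Real.log_mul p3.ne' p2.ne',
          Real.log_mul p4.ne' p1.ne'] at this
        have h5 := mul_le_mul_of_nonneg_left this h0.le
        linarith
    rw [Finset.sum_sub_distrib] at this
    linarith
  have e : fEnt ν (fun w => (B w, x w)) - fEnt ν B -
      (fEnt ν (fun w => (A w, x w)) - fEnt ν A) =
      ∑ w, ν w * (Real.log (mAx w) + Real.log (mB w) - Real.log (mBx w)
      - Real.log (mA w)) := by
    simp only [fEnt, ← Finset.sum_sub_distrib]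
    apply Finset.sum_congr rfl
    intro w _
    simp only [hmA, hmB, hmAx, hmBx]
    ring
  linarith

lemma zmod2_cases (a : ZMod 2) : a = 0 ∨ a = 1 := by
  revert a; decide

/-- The core induction on the blocklength. -/
lemma core_ineq {W S : Type*} [Fintype W] [Fintype S] (ν : W → ℝ) (hν : ∀ w, 0 ≤ ν w)
    (a b : S → ZMod 2) (p β : ℝ) (hpβ : 0 ≤ β * p) :
    ∀ (n : ℕ) (P : Fin n → S → ℝ), (∀ t s, 0 ≤ P t s) → (∀ t, ∑ s, P t s = 1) →
    (∀ t, ∑ s, P t s * (if b s = 1 then 1 else 0) = p) →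
    (∀ t, ∑ s, P t s * (if a s = 1 ∨ b s = 1 then 1 else 0) = β * p) →
    ∀ x : W → (Fin n → S) → Fin n → ZMod 2,
    (∀ w g g' t, (∀ s, s < t → g s = g' s) → x w g t = x w g' t) →
    ∀ (α α' : Type) (A : W → α) (B : W → α'), (∀ w w', B w = B w' → A w = A w') →
    0 ≤ ∑ g : Fin n → S, (∏ t, P t (g t)) *
      (β * (fEnt ν (fun w => (A w, fun t => b (g t) * x w g t)) - fEnt ν A) -
        (fEnt ν (fun w => (B w, fun t => (a (g t) * x w g t, b (g t) * x w g t)))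
          - fEnt ν B)) := by
  intro n
  induction n with
  | zero =>
    intro P _ _ _ _ x _ α α' A B _
    apply le_of_eq
    symm
    apply Finset.sum_eq_zero
    intro g _
    rw [fEnt_congr ν _ A, fEnt_congr ν (fun w => (B w, _)) B]
    · ring
    · intro w w'
      simp only [Prod.mk.injEq, and_iff_left_iff_imp]
      intro _
      exact Subsingleton.elim _ _
    · intro w w'
      simp only [Prod.mk.injEq, and_iff_left_iff_imp]
      intro _
      exact Subsingleton.elim _ _
  | succ n ih =>
    intro P hP0 hP1 hPb hPab x hx α α' A B hAB
    rw [← (Fin.consEquiv (fun _ : Fin (n+1) => S)).sum_comp, Fintype.sum_prod_type]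
    by_cases hS : IsEmpty S
    · simp
    rw [not_isEmpty_iff] at hS
    obtain ⟨s₀⟩ := hS
    let x0 : W → ZMod 2 := fun w => x w (fun _ => s₀) 0
    have hx0 : ∀ w g, x w g 0 = x0 w := fun w g => hx _ _ _ _ (fun s hs => absurd hs (Fin.not_lt_zero s))
    let x' : S → W → (Fin n → S) → Fin n → ZMod 2 :=
      fun s w g t => x w (Fin.cons s g) t.succ
    have hx' : ∀ s w g g' t, (∀ r, r < t → g r = g' r) → x' s w g t = x' s w g' t := by
      intro s w g g' t h
      apply hx
      intro r
      refine Fin.cases ?_ (fun r => ?_) r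
      · intro _; simp
      · intro hr
        simpa using h r (by simpa using hr)
    let A' : S → W → α × ZMod 2 := fun s w => (A w, b s * x0 w)
    let B' : S → W → α' × ZMod 2 × ZMod 2 := fun s w => (B w, a s * x0 w, b s * x0 w)
    have hAB' : ∀ s w w', B' s w = B' s w' → A' s w = A' s w' := by
      intro s w w' h
      simp only [A', B', Prod.mk.injEq] at h ⊢
      exact ⟨hAB _ _ h.1, h.2.2⟩
    have hprod : ∑ g : Fin n → S, (∏ t, P (Fin.succ t) (g t)) = 1 := by
      rw [← Fintype.piFinset_univ, ← Finset.prod_univ_sum]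
      simp [hP1]
    have IH := fun s => ih (fun t => P t.succ) (fun t => hP0 _) (fun t => hP1 _)
      (fun t => hPb _) (fun t => hPab _) (x' s) (hx' s) _ _ (A' s) (B' s) (hAB' s)
    have split : ∀ s, ∑ g : Fin n → S, (∏ t, P t (((Fin.consEquiv (fun _ : Fin (n+1) => S)) (s, g)) t)) *
      (β * (fEnt ν (fun w => (A w, fun t => b ((Fin.consEquiv (fun _ : Fin (n+1) => S)) (s, g) t) * x w ((Fin.consEquiv (fun _ : Fin (n+1) => S)) (s, g)) t)) - fEnt ν A) -
        (fEnt ν (fun w => (B w, fun t => (a ((Fin.consEquiv (fun _ : Fin (n+1) => S)) (s, g) t) * x w ((Fin.consEquiv (fun _ : Fin (n+1) => S)) (s, g)) t, b ((Fin.consEquiv (fun _ : Fin (n+1) => S)) (s, g) t) * x w ((Fin.consEquiv (fun _ : Fin (n+1) => S)) (s, g)) t)))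
          - fEnt ν B)) =
        P 0 s * (∑ g : Fin n → S, (∏ t, P (Fin.succ t) (g t)) *
      (β * (fEnt ν (fun w => (A' s w, fun t => b (g t) * x' s w g t)) - fEnt ν (A' s)) -
        (fEnt ν (fun w => (B' s w, fun t => (a (g t) * x' s w g t, b (g t) * x' s w g t)))
          - fEnt ν (B' s)))) + P 0 s * (β * (fEnt ν (A' s) - fEnt ν A) - (fEnt ν (B' s) - fEnt ν B)) := by
      intro s
      rw [← one_mul (β * (fEnt ν (A' s) - fEnt ν A) - (fEnt ν (B' s) - fEnt ν B)), ← hprod,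
        Finset.sum_mul, ← mul_add, ← Finset.sum_add_distrib, Finset.mul_sum]
      apply Finset.sum_congr rfl
      intro g _
      rw [Fin.prod_univ_succ]
      rw [fEnt_congr ν (fun w => (A w, _)) (fun w => (A' s w, fun t => b (g t) * x' s w g t)),
        fEnt_congr ν (fun w => (B w, _)) (fun w => (B' s w, fun t => (a (g t) * x' s w g t, b (g t) * x' s w g t)))]
      · simp only [Fin.consEquiv_apply, Fin.cons_zero, Fin.cons_succ]
        ring
      · intro w w'
        simp only [B', x', Prod.mk.injEq, funext_iff, Fin.forall_fin_succ, Fin.consEquiv_apply,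
          Fin.cons_zero, Fin.cons_succ, hx0]
        tauto
      · intro w w'
        simp only [A', x', Prod.mk.injEq, funext_iff, Fin.forall_fin_succ, Fin.consEquiv_apply,
          Fin.cons_zero, Fin.cons_succ, hx0]
        tauto
    simp only [split]
    rw [Finset.sum_add_distrib]
    apply add_nonneg
    · exact Finset.sum_nonneg (fun s _ => mul_nonneg (hP0 _ _) (IH s))
    · have hA' : ∀ s, fEnt ν (A' s) - fEnt ν A = (if b s = 1 then 1 else 0) *
          (fEnt ν (fun w => (A w, x0 w)) - fEnt ν A) := by
        intro s
        rcases zmod2_cases (b s) with h | h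
        · rw [fEnt_congr ν (A' s) A]
          · simp [h]
          · simp [A', h]
        · simp [A', h]
      have hB' : ∀ s, fEnt ν (B' s) - fEnt ν B = (if a s = 1 ∨ b s = 1 then 1 else 0) *
          (fEnt ν (fun w => (B w, x0 w)) - fEnt ν B) := by
        intro s
        rcases zmod2_cases (a s) with h | h <;> rcases zmod2_cases (b s) with h2 | h2
        · rw [fEnt_congr ν (B' s) B]
          · simp [h, h2]
          · simp [B', h, h2]
        all_goals
          rw [fEnt_congr ν (B' s) (fun w => (B w, x0 w))]
          · simp [h, h2]
          · simp [B', h, h2]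
      have hsum : ∑ s, P 0 s * (β * (fEnt ν (A' s) - fEnt ν A) - (fEnt ν (B' s) - fEnt ν B)) =
          β * (∑ s, P 0 s * (if b s = 1 then 1 else 0)) * (fEnt ν (fun w => (A w, x0 w)) - fEnt ν A)
          - (∑ s, P 0 s * (if a s = 1 ∨ b s = 1 then 1 else 0)) *
            (fEnt ν (fun w => (B w, x0 w)) - fEnt ν B) := by
        rw [Finset.mul_sum, Finset.sum_mul, Finset.sum_mul, ← Finset.sum_sub_distrib]
        apply Finset.sum_congr rfl
        intro s _
        rw [hA', hB']
        ring
      rw [hsum, hPb, hPab, ← mul_sub]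
      exact mul_nonneg hpβ (sub_nonneg.2 (fEnt_submod ν hν A B x0 hAB))

lemma sum_negMulLog_eq_fEnt {W α : Type*} [Fintype W] [Fintype α] (ν : W → ℝ) (φ : W → α) :
    ∑ c, Real.negMulLog (pr ν (fun w => φ w = c)) = fEnt ν φ := by
  classical
  have : ∀ c, Real.negMulLog (pr ν (fun w => φ w = c)) =
      ∑ w, if φ w = c then -(ν w * Real.log (fibMass ν φ w)) else 0 := by
    intro c
    have e : ∀ w, (if φ w = c then -(ν w * Real.log (fibMass ν φ w)) else 0) =
        (if φ w = c then ν w else 0) * -Real.log (pr ν (fun w => φ w = c)) := by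
      intro w
      split_ifs with h
      · subst h
        simp only [fibMass, pr]
        ring
      · ring
    simp only [e]
    rw [← Finset.sum_mul, Real.negMulLog]
    have : pr ν (fun w => φ w = c) = ∑ w, if φ w = c then ν w else 0 := by
      simp only [pr]
    rw [← this]; ring
  simp only [this]
  rw [Finset.sum_comm]
  simp [fEnt]

lemma pr_nonneg {Ω : Type*} [Fintype Ω] (μ : Ω → ℝ) (h : ∀ ω, 0 ≤ μ ω) (E : Ω → Prop) :
    0 ≤ pr μ E := by
  unfold pr
  apply Finset.sum_nonneg
  intro i _
  split_ifs
  · exact h i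
  · exact le_rfl

open Classical in
lemma pr_fiber {Ω S : Type*} [Fintype Ω] [Fintype S] (μ : Ω → ℝ) (X : Ω → S) (E : S → Prop)
    (F : Ω → Prop) :
    pr μ (fun ω => E (X ω) ∧ F ω) = ∑ s, if E s then pr μ (fun ω => X ω = s ∧ F ω) else 0 := by
  have : ∀ s, (if E s then pr μ (fun ω => X ω = s ∧ F ω) else 0) =
      ∑ ω, if s = X ω then (if E (X ω) ∧ F ω then μ ω else 0) else 0 := by
    intro s
    simp only [pr]
    split_ifs with h
    · apply Finset.sum_congr rfl
      intro ω _
      by_cases h1 : s = X ω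
      · subst h1; simp [h]
      · simp [h1, Ne.symm h1]
    · symm
      apply Finset.sum_eq_zero
      intro ω _
      by_cases h1 : s = X ω
      · subst h1; simp [h]
      · simp [h1]
  simp only [this]
  rw [Finset.sum_comm]
  simp [pr]
  congr!

lemma pr_fiber' {Ω S : Type*} [Fintype Ω] [Fintype S] (μ : Ω → ℝ) (X : Ω → S) (E : S → Prop)
    [DecidablePred E] :
    ∑ s, pr μ (fun ω => X ω = s) * (if E s then 1 else 0) = pr μ (fun ω => E (X ω)) := by
  have := pr_fiber μ X E (fun _ => True)
  simp only [and_true] at this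
  rw [this]
  simp only [mul_ite, mul_one, mul_zero]

lemma pr_or {Ω : Type*} [Fintype Ω] (μ : Ω → ℝ) (E F : Ω → Prop) :
    pr μ (fun ω => E ω ∨ F ω) = pr μ E + pr μ F - pr μ (fun ω => E ω ∧ F ω) := by
  simp only [pr, ← Finset.sum_add_distrib, ← Finset.sum_sub_distrib]
  apply Finset.sum_congr rfl
  intro ω _
  by_cases h1 : E ω <;> by_cases h2 : F ω <;> simp [h1, h2]

lemma pr_total {Ω S : Type*} [Fintype Ω] [Fintype S] (μ : Ω → ℝ) (hμ1 : ∑ ω, μ ω = 1)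
    (X : Ω → S) : ∑ s, pr μ (fun ω => X ω = s) = 1 := by
  have := pr_fiber' μ X (fun _ => True)
  simp only [if_true, mul_one] at this
  rw [this]
  simp [pr, hμ1]

/-- Conditional entropy as an average of entropies over the law of `W1`. -/
lemma condEnt_eq {Ω 𝒲₁ 𝒲₂ 𝒢 C : Type*} [Fintype Ω] [Fintype 𝒲₁] [Fintype 𝒲₂] [Fintype 𝒢]
    [Fintype C] (μ : Ω → ℝ) (hμ1 : ∑ ω, μ ω = 1)
    (W1 : Ω → 𝒲₁) (W2 : Ω → 𝒲₂) (G : Ω → 𝒢)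
    (hInd : ∀ w1 w2 g, pr μ (fun ω => W1 ω = w1 ∧ W2 ω = w2 ∧ G ω = g) =
      pr μ (fun ω => W1 ω = w1) * pr μ (fun ω => W2 ω = w2) * pr μ (fun ω => G ω = g))
    (Y : Ω → C) (y : 𝒲₁ → 𝒲₂ → 𝒢 → C) (hY : ∀ ω, Y ω = y (W1 ω) (W2 ω) (G ω)) :
    condEnt μ Y (fun ω => (W2 ω, G ω)) =
      ∑ w2, pr μ (fun ω => W2 ω = w2) * ∑ g, pr μ (fun ω => G ω = g) *
        fEnt (fun w1 => pr μ (fun ω => W1 ω = w1)) (fun w1 => y w1 w2 g) := by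
  classical
  unfold condEnt
  rw [Fintype.sum_prod_type]
  apply Finset.sum_congr rfl
  intro w2 _
  rw [Finset.mul_sum]
  apply Finset.sum_congr rfl
  intro g _
  rw [← sum_negMulLog_eq_fEnt, Finset.mul_sum, Finset.mul_sum]
  apply Finset.sum_congr rfl
  intro c _
  have hJ : ∀ E : 𝒲₁ → Prop, pr μ (fun ω => E (W1 ω) ∧ (W2 ω = w2 ∧ G ω = g)) =
      pr (fun w1 => pr μ (fun ω => W1 ω = w1)) E *
        (pr μ (fun ω => W2 ω = w2) * pr μ (fun ω => G ω = g)) := by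
    intro E
    rw [pr_fiber]
    simp only [hInd]
    conv_rhs => rw [pr]
    rw [Finset.sum_mul]
    apply Finset.sum_congr rfl
    intro w _
    split_ifs <;> ring
  have h1 : pr μ (fun ω => (W2 ω, G ω) = (w2, g)) =
      pr μ (fun ω => W2 ω = w2) * pr μ (fun ω => G ω = g) := by
    have := hJ (fun _ => True)
    simp only [true_and] at this
    simp only [Prod.mk.injEq]
    rw [this]
    have e : pr (fun w1 => pr μ (fun ω => W1 ω = w1)) (fun _ => True) = 1 := by
      rw [← pr_total μ hμ1 W1]
      simp [pr]
    rw [e, one_mul]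
  have h2 : pr μ (fun ω => Y ω = c ∧ (W2 ω, G ω) = (w2, g)) =
      pr (fun w1 => pr μ (fun ω => W1 ω = w1)) (fun w1 => y w1 w2 g = c) *
        (pr μ (fun ω => W2 ω = w2) * pr μ (fun ω => G ω = g)) := by
    rw [← hJ]
    congr 1
    funext ω
    simp only [Prod.mk.injEq, hY, eq_iff_iff]
    constructor
    · rintro ⟨h, rfl, rfl⟩; exact ⟨h, rfl, rfl⟩
    · rintro ⟨h, rfl, rfl⟩; exact ⟨h, rfl, rfl⟩
  rw [h1, h2]
  by_cases h0 : pr μ (fun ω => W2 ω = w2) * pr μ (fun ω => G ω = g) = 0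
  · rw [h0, zero_mul, ← mul_assoc, h0, zero_mul]
  · rw [mul_div_cancel_right₀ _ h0]
    ring

/-- Extremal entropy inequality for correlated channels, Lemma 1:
for the two-user erasure interference channel with delayed CSIT and spatially
correlated links, with `0 < p ≤ 1`, `q = 1 - p`, `-1 ≤ ρ ≤ 1`, `β = 2 - p - qρ`,
`H[Y₂ⁿ | (W₂, Gⁿ)] ≥ (1/β) · H[Y₁ⁿ | (W₂, Gⁿ)]`. -/
theorem stmt_6 {Ω 𝒲₁ 𝒲₂ : Type*} [Fintype Ω] [Fintype 𝒲₁] [Fintype 𝒲₂]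
    (μ : Ω → ℝ) (hμ0 : ∀ ω, 0 ≤ μ ω) (hμ1 : ∑ ω, μ ω = 1)
    (p q ρ β : ℝ) (hp0 : 0 < p) (hp1 : p ≤ 1) (hq : q = 1 - p)
    (hρ1 : -1 ≤ ρ) (hρ2 : ρ ≤ 1) (hβ : β = 2 - p - q * ρ)
    (n : ℕ)
    (W1 : Ω → 𝒲₁) (W2 : Ω → 𝒲₂)
    (G : Fin n → Ω → ZMod 2 × ZMod 2 × ZMod 2 × ZMod 2)
    (X1 X2 Y1 Y2 : Fin n → Ω → ZMod 2)
    -- W₁, W₂ and the whole gain process are mutually independent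
    (hMutIndep : ∀ (w1 : 𝒲₁) (w2 : 𝒲₂) (g : Fin n → ZMod 2 × ZMod 2 × ZMod 2 × ZMod 2),
      pr μ (fun ω => W1 ω = w1 ∧ W2 ω = w2 ∧ (fun t => G t ω) = g) =
        pr μ (fun ω => W1 ω = w1) * pr μ (fun ω => W2 ω = w2) *
          pr μ (fun ω => (fun t => G t ω) = g))
    -- the states G[t] are independent across time …
    (hTimeIndep : ∀ g : Fin n → ZMod 2 × ZMod 2 × ZMod 2 × ZMod 2,
      pr μ (fun ω => (fun t => G t ω) = g) = ∏ t, pr μ (fun ω => G t ω = g t))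
    -- … and identically distributed across time
    (hIdent : ∀ (t t' : Fin n) (s : ZMod 2 × ZMod 2 × ZMod 2 × ZMod 2),
      pr μ (fun ω => G t ω = s) = pr μ (fun ω => G t' ω = s))
    -- the links of the two transmitters are independent at each time
    (hTxIndep : ∀ (t : Fin n) (a b c d : ZMod 2),
      pr μ (fun ω => g11 (G t ω) = a ∧ g12 (G t ω) = b ∧ g21 (G t ω) = c ∧ g22 (G t ω) = d) =
        pr μ (fun ω => g11 (G t ω) = a ∧ g12 (G t ω) = b) *
          pr μ (fun ω => g21 (G t ω) = c ∧ g22 (G t ω) = d))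
    -- each link is Bernoulli(p)
    (hBern : ∀ t : Fin n,
      pr μ (fun ω => g11 (G t ω) = 1) = p ∧ pr μ (fun ω => g12 (G t ω) = 1) = p ∧
      pr μ (fun ω => g21 (G t ω) = 1) = p ∧ pr μ (fun ω => g22 (G t ω) = 1) = p)
    -- the two links of each transmitter form a (p,ρ)-correlated Bernoulli pair
    (hCorr : ∀ t : Fin n,
      pr μ (fun ω => g11 (G t ω) = 1 ∧ g12 (G t ω) = 1) = p ^ 2 + p * q * ρ ∧
      pr μ (fun ω => g21 (G t ω) = 1 ∧ g22 (G t ω) = 1) = p ^ 2 + p * q * ρ)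
    -- delayed CSIT: Xᵢ[t] is a deterministic function of Wᵢ and G[1..t-1]
    (hX1 : ∀ t : Fin n, ∃ f : 𝒲₁ → (Fin t.val → ZMod 2 × ZMod 2 × ZMod 2 × ZMod 2) → ZMod 2,
      ∀ ω, X1 t ω = f (W1 ω) (fun s => G ⟨s.val, s.isLt.trans t.isLt⟩ ω))
    (hX2 : ∀ t : Fin n, ∃ f : 𝒲₂ → (Fin t.val → ZMod 2 × ZMod 2 × ZMod 2 × ZMod 2) → ZMod 2,
      ∀ ω, X2 t ω = f (W2 ω) (fun s => G ⟨s.val, s.isLt.trans t.isLt⟩ ω))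
    -- channel outputs
    (hY1 : ∀ t ω, Y1 t ω = g11 (G t ω) * X1 t ω + g21 (G t ω) * X2 t ω)
    (hY2 : ∀ t ω, Y2 t ω = g12 (G t ω) * X1 t ω + g22 (G t ω) * X2 t ω) :
    condEnt μ (fun ω => fun t => Y2 t ω) (fun ω => (W2 ω, fun t => G t ω)) ≥
      (1 / β) * condEnt μ (fun ω => fun t => Y1 t ω) (fun ω => (W2 ω, fun t => G t ω)) := by
  classical
  have hβ1 : 1 ≤ β := by
    rw [hβ, hq]; nlinarith
  choose f1 hf1 using hX1
  choose f2 hf2 using hX2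
  let ν : 𝒲₁ → ℝ := fun w1 => pr μ (fun ω => W1 ω = w1)
  have hν : ∀ w, 0 ≤ ν w := fun w => pr_nonneg μ hμ0 _
  let x : 𝒲₁ → (Fin n → ZMod 2 × ZMod 2 × ZMod 2 × ZMod 2) → Fin n → ZMod 2 :=
    fun w g t => f1 t w (fun s => g ⟨s.val, s.isLt.trans t.isLt⟩)
  let z : 𝒲₂ → (Fin n → ZMod 2 × ZMod 2 × ZMod 2 × ZMod 2) → Fin n → ZMod 2 :=
    fun w g t => f2 t w (fun s => g ⟨s.val, s.isLt.trans t.isLt⟩)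
  rw [condEnt_eq μ hμ1 W1 W2 (fun ω t => G t ω) hMutIndep (fun ω => fun t => Y2 t ω)
      (fun w1 w2 g t => g12 (g t) * x w1 g t + g22 (g t) * z w2 g t)
      (fun ω => by funext t; rw [hY2, hf1, hf2]),
    condEnt_eq μ hμ1 W1 W2 (fun ω t => G t ω) hMutIndep (fun ω => fun t => Y1 t ω)
      (fun w1 w2 g t => g11 (g t) * x w1 g t + g21 (g t) * z w2 g t)
      (fun ω => by funext t; rw [hY1, hf1, hf2])]
  rw [ge_iff_le, Finset.mul_sum]
  apply Finset.sum_le_sum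
  intro w2 _
  rw [mul_left_comm]
  apply mul_le_mul_of_nonneg_left _ (pr_nonneg μ hμ0 _)
  have key := core_ineq ν hν g11 g12 p β (by positivity) n
    (fun t s => pr μ (fun ω => G t ω = s)) (fun t s => pr_nonneg μ hμ0 _)
    (fun t => pr_total μ hμ1 (G t))
    (fun t => by rw [pr_fiber' μ (G t) (fun s => g12 s = 1)]; exact (hBern t).2.1)
    (fun t => by
      rw [pr_fiber' μ (G t) (fun s => g11 s = 1 ∨ g12 s = 1), pr_or, (hBern t).1, (hBern t).2.1,
        (hCorr t).1, hβ, hq]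
      ring)
    x (fun w g g' t h => by
      simp only [x]
      congr 1
      funext s
      exact h _ s.isLt)
    Unit Unit (fun _ => ()) (fun _ => ()) (fun _ _ _ => rfl)
  rw [one_div, inv_mul_le_iff₀ (by linarith), Finset.mul_sum, ← sub_nonneg,
    ← Finset.sum_sub_distrib]
  refine key.trans (Finset.sum_le_sum (fun g _ => ?_))
  rw [hTimeIndep g, mul_left_comm, ← mul_sub]
  apply mul_le_mul_of_nonneg_left _ (Finset.prod_nonneg (fun t _ => pr_nonneg μ hμ0 _))
  have e2 : fEnt ν (fun w => ((), fun t => g12 (g t) * x w g t)) =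
      fEnt ν (fun w1 t => g12 (g t) * x w1 g t + g22 (g t) * z w2 g t) := by
    apply fEnt_congr
    intro w w'
    simp [funext_iff]
  have e1 : fEnt ν (fun w1 t => g11 (g t) * x w1 g t + g21 (g t) * z w2 g t) ≤
      fEnt ν (fun w => ((), fun t => (g11 (g t) * x w g t, g12 (g t) * x w g t))) := by
    apply fEnt_mono ν hν
    intro w w' h
    simp only [Prod.mk.injEq, funext_iff, true_and] at h ⊢
    intro t
    rw [(h t).1]
  have e0 : 0 ≤ (β - 1) * fEnt ν (fun _ : 𝒲₁ => ()) := by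
    apply mul_nonneg (by linarith)
    have : fEnt ν (fun _ : 𝒲₁ => ()) = 0 := by
      have hs : ∑ w, ν w = 1 := pr_total μ hμ1 W1
      simp [fEnt, fibMass, hs]
    rw [this]
  rw [e2]
  linarith
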